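/- Orthogonality of the components of the working-MSM efficient influence function: E_p[ D*_s · D*_t ] = 0 for all s ≠ t in {0, …, K+1}, and consequently the variance of the full efficient influence function is the sum of the component variances: E_p[ (Σ_{t=0}^{K+1} D*_t)² ] = Σ_{t=0}^{K+1} E_p[(D*_t)²] = Σ_{t=0}^{K+1} σ²_t. -/

import Mathlib

/-!
Longitudinal data structure `O = (L(0), A(0), …, A(K), L(K+1))` with full-support pmf `p`.
Histories are encoded by full trajectories together with agreement predicates on time prefixes;
a sum over histories `l̄(t)` is encoded as a sum over full covariate trajectories whose
coordinates beyond `t` are pinned to an arbitrary base point `l₀` (`tailEq`).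
-/

open Finset
open scoped Classical

noncomputable section

variable {K : ℕ} {L : Fin (K + 2) → Type} {A : Fin (K + 1) → Type}

/-- Covariate trajectories. -/
abbrev Traj (K : ℕ) (L : Fin (K + 2) → Type) : Type := ∀ s : Fin (K + 2), L s

/-- Treatment trajectories. -/
abbrev Trt (K : ℕ) (A : Fin (K + 1) → Type) : Type := ∀ s : Fin (K + 1), A s

/-- Observations. -/
abbrev Obs (K : ℕ) (L : Fin (K + 2) → Type) (A : Fin (K + 1) → Type) : Type :=
  Traj K L × Trt K A

/-- Agreement of covariate trajectories on time indices `< t` (i.e. they share `l̄(t-1)`). -/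
def aL (t : ℕ) (l l' : Traj K L) : Prop := ∀ s : Fin (K + 2), (s : ℕ) < t → l s = l' s

/-- Agreement of treatment trajectories on time indices `< t` (i.e. they share `ā(t-1)`). -/
def aA (t : ℕ) (a a' : Trt K A) : Prop := ∀ s : Fin (K + 1), (s : ℕ) < t → a s = a' s

variable [∀ t, Fintype (L t)] [∀ t, Fintype (A t)]

/-- Mass of the event that the covariates agree with `l` on indices `< tL` and the treatments
agree with `a` on indices `< tA`. -/
def marg (p : Obs K L A → ℝ) (tL tA : ℕ) (l : Traj K L) (a : Trt K A) : ℝ :=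
  ∑ o' : Obs K L A, if aL tL l o'.1 ∧ aA tA a o'.2 then p o' else 0

/-- The conditional factor `q_t(l_t ∣ l̄(t-1), ā(t-1))`. -/
def qC (p : Obs K L A → ℝ) (t : ℕ) (l : Traj K L) (a : Trt K A) : ℝ :=
  marg p (t + 1) t l a / marg p t t l a

/-- The treatment mechanism factor `g_t(a_t ∣ l̄(t), ā(t-1))`. -/
def gC (p : Obs K L A → ℝ) (t : ℕ) (l : Traj K L) (a : Trt K A) : ℝ :=
  marg p (t + 1) (t + 1) l a / marg p (t + 1) t l a

/-- The cumulative treatment probability `g_{0:t-1}(ā(t-1), l̄(t-1))`; in particular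
`gCum p 0 = 1` is the convention `g_{0:-1} = 1`. -/
def gCum (p : Obs K L A → ℝ) (t : ℕ) (l : Traj K L) (a : Trt K A) : ℝ :=
  ∏ m ∈ Finset.range t, gC p m l a

/-- The treatment trajectory determined by the regimen `d` along the covariates `l`. -/
def aOf (d : ∀ t : Fin (K + 1), Traj K L → A t) (l : Traj K L) : Trt K A := fun s => d s l

/-- A regimen is adapted: `d_t` depends only on `l̄(t)`. -/
def Adapted (d : ∀ t : Fin (K + 1), Traj K L → A t) : Prop :=
  ∀ t : Fin (K + 1), ∀ l l' : Traj K L, aL ((t : ℕ) + 1) l l' → d t l = d t l'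

/-- The event `ā(t-1) = d(l̄(t-1))`. -/
def follows (d : ∀ t : Fin (K + 1), Traj K L → A t) (t : ℕ) (o : Obs K L A) : Prop :=
  ∀ s : Fin (K + 1), (s : ℕ) < t → o.2 s = d s o.1

/-- The inverse probability weight
`H^d_t(ā(t-1), l̄(t-1)) = 1{ā(t-1) = d(l̄(t-1))} / g_{0:t-1}`; `Hd p d 0 = 1`. -/
def Hd (p : Obs K L A → ℝ) (d : ∀ t : Fin (K + 1), Traj K L → A t) (t : ℕ)
    (o : Obs K L A) : ℝ :=
  (if follows d t o then (1 : ℝ) else 0) / gCum p t o.1 o.2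

/-- The sequential regression `Q̄^d_t(l̄(t-1))`, defined downward from
`Q̄^d_{K+2}(l̄(K+1)) = y(l_{K+1})` by
`Q̄^d_t(l̄(t-1)) = Σ_{l_t} q_t(l_t ∣ l̄(t-1), d(l̄(t-1))) Q̄^d_{t+1}(l̄(t))`. -/
def Qbar (p : Obs K L A → ℝ) (y : L (Fin.last (K + 1)) → ℝ)
    (d : ∀ t : Fin (K + 1), Traj K L → A t) (t : ℕ) (l : Traj K L) : ℝ :=
  if ht : t < K + 2 then
    ∑ v : L ⟨t, ht⟩,
      qC p t (Function.update l ⟨t, ht⟩ v) (aOf d (Function.update l ⟨t, ht⟩ v)) *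
        Qbar p y d (t + 1) (Function.update l ⟨t, ht⟩ v)
  else y (l (Fin.last (K + 1)))
termination_by K + 2 - t
decreasing_by omega

/-- The G-computation mass `P^d_t(l̄(t)) = Π_{m=0}^{t} q_m(l_m ∣ l̄(m-1), d(l̄(m-1)))`. -/
def Pd (p : Obs K L A → ℝ) (d : ∀ t : Fin (K + 1), Traj K L → A t) (t : ℕ)
    (l : Traj K L) : ℝ :=
  ∏ m ∈ Finset.range (t + 1), qC p m l (aOf d l)

/-- `l` agrees with the base point `l₀` on indices `> t`: summing a function of `l̄(t)` over
trajectories pinned to `l₀` beyond `t` realizes the sum over histories `l̄(t)`. -/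
def tailEq (t : ℕ) (l₀ l : Traj K L) : Prop := ∀ s : Fin (K + 2), t < (s : ℕ) → l s = l₀ s

/-- The `t`-th component of the efficient influence function,
`D^{*,d}_t = H^d_t · (Q̄^d_{t+1} - Q̄^d_t)` (with `H^d_0 = 1`, so the `t = 0` component is
`Q̄^d_1(l_0) - Q̄^d_0`). -/
def Dst (p : Obs K L A → ℝ) (y : L (Fin.last (K + 1)) → ℝ)
    (d : ∀ t : Fin (K + 1), Traj K L → A t) (t : ℕ) (o : Obs K L A) : ℝ :=
  Hd p d t o * (Qbar p y d (t + 1) o.1 - Qbar p y d t o.1)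

/-- The conditional covariance
`Σ_t(d1,d2)(ā(t-1), l̄(t-1)) = Σ_{l_t} q_t(l_t ∣ l̄(t-1), ā(t-1)) (Q̄^{d1}_{t+1} - Q̄^{d1}_t)(Q̄^{d2}_{t+1} - Q̄^{d2}_t)`. -/
def Scov (p : Obs K L A → ℝ) (y : L (Fin.last (K + 1)) → ℝ)
    (d1 d2 : ∀ t : Fin (K + 1), Traj K L → A t) (t : ℕ) (ht : t < K + 2)
    (l : Traj K L) (a : Trt K A) : ℝ :=
  ∑ v : L ⟨t, ht⟩,
    qC p t (Function.update l ⟨t, ht⟩ v) a *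
      ((Qbar p y d1 (t + 1) (Function.update l ⟨t, ht⟩ v) - Qbar p y d1 t l) *
        (Qbar p y d2 (t + 1) (Function.update l ⟨t, ht⟩ v) - Qbar p y d2 t l))

/-- The `t`-th component of the working-MSM efficient influence function,
`D*_t = Σ_{d ∈ 𝒟} h(d,t) H^d_t (Q̄^d_{t+1} - Q̄^d_t)` (with `H^d_0 = 1`). -/
def DstM {D : Type} [Fintype D] (p : Obs K L A → ℝ) (y : L (Fin.last (K + 1)) → ℝ)
    (ds : D → ∀ t : Fin (K + 1), Traj K L → A t) (h : D → ℕ → ℝ) (t : ℕ)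
    (o : Obs K L A) : ℝ :=
  ∑ i : D, h i t *
    (Hd p (ds i) t o * (Qbar p y (ds i) (t + 1) o.1 - Qbar p y (ds i) t o.1))

theorem aL.mono {s t : ℕ} (hst : s ≤ t) {l l' : Traj K L} (hl : aL t l l') : aL s l l' :=
  fun i hi => hl i (hi.trans_le hst)

theorem aL.symm {t : ℕ} {l l' : Traj K L} (hl : aL t l l') : aL t l' l :=
  fun i hi => (hl i hi).symm

theorem aL.trans {t : ℕ} {l l' l'' : Traj K L} (h₁ : aL t l l') (h₂ : aL t l' l'') :
    aL t l l'' :=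
  fun i hi => (h₁ i hi).trans (h₂ i hi)

theorem aA.mono {s t : ℕ} (hst : s ≤ t) {a a' : Trt K A} (ha : aA t a a') : aA s a a' :=
  fun i hi => ha i (hi.trans_le hst)

theorem aA.symm {t : ℕ} {a a' : Trt K A} (ha : aA t a a') : aA t a' a :=
  fun i hi => (ha i hi).symm

theorem aA.trans {t : ℕ} {a a' a'' : Trt K A} (h₁ : aA t a a') (h₂ : aA t a' a'') :
    aA t a a'' :=
  fun i hi => (h₁ i hi).trans (h₂ i hi)

theorem aL_update (l : Traj K L) (t : Fin (K + 2)) (v : L t) :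
    aL (t : ℕ) (Function.update l t v) l :=
  fun i hi => Function.update_of_ne (fun hit => by simp [hit] at hi) _ _

theorem aL.update {t : Fin (K + 2)} {l l' : Traj K L} (hl : aL (t : ℕ) l l') (v : L t) :
    aL ((t : ℕ) + 1) (Function.update l t v) (Function.update l' t v) := by
  intro i hi
  by_cases hit : i = t
  · subst hit
    simp
  · rw [Function.update_of_ne hit, Function.update_of_ne hit]
    exact hl i (by have := Fin.val_ne_of_ne hit; omega)

/-- The updated trajectory agrees with `l'` up to and including time `t` exactly when the original
one agrees with `l'` before `t` and the new value is that of `l'`. -/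
theorem aL_succ_update_iff {t : Fin (K + 2)} {l l' : Traj K L} {v : L t} :
    aL ((t : ℕ) + 1) (Function.update l t v) l' ↔ aL (t : ℕ) l l' ∧ v = l' t := by
  constructor
  · intro hl
    exact ⟨(aL_update l t v).symm.trans (hl.mono (Nat.le_succ _)),
      by simpa using hl t (Nat.lt_succ_self _)⟩
  · rintro ⟨hl, rfl⟩
    simpa using hl.update (l' t)

theorem Adapted.aA_aOf {d : ∀ t : Fin (K + 1), Traj K L → A t} (hd : Adapted d) {t : ℕ}
    {l l' : Traj K L} (hl : aL t l l') : aA t (aOf d l) (aOf d l') :=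
  fun s hs => hd s l l' (hl.mono hs)

/-- A function of the observation that depends only on the history before time `t`. -/
def DependsOnHistory (t : ℕ) (f : Obs K L A → ℝ) : Prop :=
  ∀ o o' : Obs K L A, aL t o.1 o'.1 → aA t o.2 o'.2 → f o = f o'

theorem follows_congr {d : ∀ t : Fin (K + 1), Traj K L → A t} (hd : Adapted d) {t : ℕ}
    {o o' : Obs K L A} (hl : aL t o.1 o'.1) (ha : aA t o.2 o'.2) :
    follows d t o ↔ follows d t o' := by
  refine forall₂_congr fun s hs => ?_
  rw [ha s hs, hd s o.1 o'.1 (hl.mono hs)]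

section Marginals

variable (p : Obs K L A → ℝ)

theorem marg_congr {tL tA : ℕ} {l l' : Traj K L} {a a' : Trt K A}
    (hl : aL tL l l') (ha : aA tA a a') : marg p tL tA l a = marg p tL tA l' a' := by
  refine Finset.sum_congr rfl fun o _ => if_congr ?_ rfl rfl
  exact ⟨fun h => ⟨hl.symm.trans h.1, ha.symm.trans h.2⟩,
    fun h => ⟨hl.trans h.1, ha.trans h.2⟩⟩

theorem marg_pos {p : Obs K L A → ℝ} (hp : ∀ o, 0 < p o) (tL tA : ℕ) (l : Traj K L)
    (a : Trt K A) : 0 < marg p tL tA l a := by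
  refine Finset.sum_pos' (fun o _ => ?_) ⟨(l, a), Finset.mem_univ _, ?_⟩
  · split_ifs
    exacts [(hp o).le, le_rfl]
  · rw [if_pos ⟨fun _ _ => rfl, fun _ _ => rfl⟩]
    exact hp _

theorem qC_congr {t : ℕ} {l l' : Traj K L} {a a' : Trt K A}
    (hl : aL (t + 1) l l') (ha : aA t a a') : qC p t l a = qC p t l' a' := by
  rw [qC, qC, marg_congr p hl ha, marg_congr p (hl.mono t.le_succ) ha]

theorem gC_congr {t : ℕ} {l l' : Traj K L} {a a' : Trt K A}
    (hl : aL (t + 1) l l') (ha : aA (t + 1) a a') : gC p t l a = gC p t l' a' := by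
  rw [gC, gC, marg_congr p hl ha, marg_congr p hl (ha.mono t.le_succ)]

theorem gCum_congr {t : ℕ} {l l' : Traj K L} {a a' : Trt K A}
    (hl : aL t l l') (ha : aA t a a') : gCum p t l a = gCum p t l' a' :=
  Finset.prod_congr rfl fun _ hm =>
    have hm := Finset.mem_range.1 hm
    gC_congr p (hl.mono hm) (ha.mono hm)

theorem Hd_dependsOnHistory {d : ∀ t : Fin (K + 1), Traj K L → A t} (hd : Adapted d) (t : ℕ) :
    DependsOnHistory t (Hd p d t) := by
  intro o o' hl ha
  simp only [Hd, gCum_congr p hl ha, follows_congr hd hl ha]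

theorem Qbar_congr (y : L (Fin.last (K + 1)) → ℝ) {d : ∀ t : Fin (K + 1), Traj K L → A t}
    (hd : Adapted d) (t : ℕ) (l l' : Traj K L) (hl : aL t l l') :
    Qbar p y d t l = Qbar p y d t l' := by
  rw [Qbar, Qbar]
  split_ifs with ht
  · refine Finset.sum_congr rfl fun v _ => ?_
    have hu : aL (t + 1) (Function.update l ⟨t, ht⟩ v) (Function.update l' ⟨t, ht⟩ v) :=
      aL.update (t := ⟨t, ht⟩) hl v
    rw [qC_congr p hu (hd.aA_aOf (hu.mono t.le_succ)), Qbar_congr y hd (t + 1) _ _ hu]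
  · rw [hl (Fin.last (K + 1)) (by simp only [Fin.val_last]; omega)]
termination_by K + 2 - t
decreasing_by omega

/-- Averaging `G` over `l_t` with the conditional factor `q_t` is the conditional expectation of
`G` given the history before `t`. -/
theorem sum_qC_update_mul (t : Fin (K + 2)) (G : Traj K L → ℝ)
    (hG : ∀ l l', aL ((t : ℕ) + 1) l l' → G l = G l') (o : Obs K L A) :
    ∑ v : L t, qC p t (Function.update o.1 t v) o.2 * G (Function.update o.1 t v) =
      (∑ o' : Obs K L A, if aL (t : ℕ) o.1 o'.1 ∧ aA (t : ℕ) o.2 o'.2 then p o' * G o'.1 else 0) /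
        marg p t t o.1 o.2 := by
  have hterm (v : L t) :
      qC p t (Function.update o.1 t v) o.2 * G (Function.update o.1 t v) =
        (∑ o' : Obs K L A, if v = o'.1 t then
          (if aL (t : ℕ) o.1 o'.1 ∧ aA (t : ℕ) o.2 o'.2 then p o' * G o'.1 else 0) else 0) /
          marg p t t o.1 o.2 := by
    rw [qC, marg_congr p (aL_update o.1 t v) (fun _ _ => rfl : aA (t : ℕ) o.2 o.2),
      div_mul_eq_mul_div, marg, Finset.sum_mul]
    congr 1
    refine Finset.sum_congr rfl fun o' _ => ?_
    by_cases hu : aL ((t : ℕ) + 1) (Function.update o.1 t v) o'.1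
    · obtain ⟨hl, hv⟩ := aL_succ_update_iff.1 hu
      simp only [hu, hl, hG _ _ hu, true_and, if_pos hv, ite_mul, zero_mul]
    · have hn := mt aL_succ_update_iff.2 hu
      rw [if_neg fun h => hu h.1, zero_mul]
      split_ifs with hv hr
      exacts [(hn ⟨hr.1, hv⟩).elim, rfl, rfl]
  simp_rw [hterm]
  rw [← Finset.sum_div, Finset.sum_comm]
  simp

/-- The tower property for a weight depending only on the history before `t`. -/
theorem sum_mul_sum_qC_update_mul {p : Obs K L A → ℝ} (hp : ∀ o, 0 < p o) (t : Fin (K + 2))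
    {F : Obs K L A → ℝ} (hF : DependsOnHistory t F) (G : Traj K L → ℝ)
    (hG : ∀ l l', aL ((t : ℕ) + 1) l l' → G l = G l') :
    ∑ o : Obs K L A, p o * (F o *
        ∑ v : L t, qC p t (Function.update o.1 t v) o.2 * G (Function.update o.1 t v)) =
      ∑ o : Obs K L A, p o * (F o * G o.1) := by
  simp_rw [sum_qC_update_mul p t G hG, Finset.sum_div, Finset.mul_sum]
  rw [Finset.sum_comm]
  refine Finset.sum_congr rfl fun o' _ => ?_
  have hm := (marg_pos hp t t o'.1 o'.2).ne'
  trans ∑ o : Obs K L A, (if aL (t : ℕ) o'.1 o.1 ∧ aA (t : ℕ) o'.2 o.2 then p o else 0) *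
    (F o' * (p o' * G o'.1) / marg p t t o'.1 o'.2)
  · refine Finset.sum_congr rfl fun o _ => ?_
    by_cases ho : aL (t : ℕ) o.1 o'.1 ∧ aA (t : ℕ) o.2 o'.2
    · rw [if_pos ho, if_pos ⟨ho.1.symm, ho.2.symm⟩, hF o o' ho.1 ho.2, marg_congr p ho.1 ho.2]
      ring
    · rw [if_neg ho, if_neg fun h => ho ⟨h.1.symm, h.2.symm⟩]
      simp
  · rw [← Finset.sum_mul]
    change marg p t t o'.1 o'.2 * _ = _
    field_simp

theorem Qbar_eq_of_follows (y : L (Fin.last (K + 1)) → ℝ)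
    {d : ∀ t : Fin (K + 1), Traj K L → A t} (hd : Adapted d) (t : Fin (K + 2))
    {o : Obs K L A} (ho : follows d t o) :
    Qbar p y d t o.1 = ∑ v : L t, qC p t (Function.update o.1 t v) o.2 *
      Qbar p y d (t + 1) (Function.update o.1 t v) := by
  rw [Qbar, dif_pos t.isLt]
  refine Finset.sum_congr rfl fun v _ => ?_
  rw [qC_congr p (fun _ _ => rfl)
    ((hd.aA_aOf (aL_update o.1 t v)).trans fun s hs => (ho s hs).symm)]

/-- The component `D^{*,d}_t` is orthogonal to every function of the history before `t`. -/
theorem sum_mul_Dst_eq_zero {p : Obs K L A → ℝ} (hp : ∀ o, 0 < p o)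
    (y : L (Fin.last (K + 1)) → ℝ) {d : ∀ t : Fin (K + 1), Traj K L → A t} (hd : Adapted d)
    (t : Fin (K + 2)) {F : Obs K L A → ℝ} (hF : DependsOnHistory t F) :
    ∑ o : Obs K L A, p o * (F o * Dst p y d t o) = 0 := by
  have hFH : DependsOnHistory t fun o => F o * Hd p d t o := fun o o' hl ha => by
    simp only [hF o o' hl ha, Hd_dependsOnHistory p hd t o o' hl ha]
  rw [← sub_eq_zero.2 (sum_mul_sum_qC_update_mul hp t hFH _ (Qbar_congr p y hd (t + 1))).symm,
    ← Finset.sum_sub_distrib]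
  refine Finset.sum_congr rfl fun o _ => ?_
  by_cases ho : follows d t o
  · rw [← Qbar_eq_of_follows p y hd t ho, Dst]
    ring
  · simp [Dst, Hd, ho]

theorem DstM_eq_sum_Dst {D : Type} [Fintype D] (y : L (Fin.last (K + 1)) → ℝ)
    (ds : D → ∀ t : Fin (K + 1), Traj K L → A t) (h : D → ℕ → ℝ) (t : ℕ) (o : Obs K L A) :
    DstM p y ds h t o = ∑ i : D, h i t * Dst p y (ds i) t o :=
  rfl

theorem DstM_dependsOnHistory {D : Type} [Fintype D] (y : L (Fin.last (K + 1)) → ℝ)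
    {ds : D → ∀ t : Fin (K + 1), Traj K L → A t} (hds : ∀ i, Adapted (ds i)) (h : D → ℕ → ℝ)
    {s t : ℕ} (hst : s < t) : DependsOnHistory t (DstM p y ds h s) := by
  intro o o' hl ha
  refine Finset.sum_congr rfl fun i _ => ?_
  rw [Hd_dependsOnHistory p (hds i) s o o' (hl.mono hst.le) (ha.mono hst.le),
    Qbar_congr p y (hds i) (s + 1) _ _ (hl.mono hst), Qbar_congr p y (hds i) s _ _ (hl.mono hst.le)]

theorem sum_mul_DstM_mul_DstM_of_lt {D : Type} [Fintype D] {p : Obs K L A → ℝ}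
    (hp : ∀ o, 0 < p o) (y : L (Fin.last (K + 1)) → ℝ)
    {ds : D → ∀ t : Fin (K + 1), Traj K L → A t} (hds : ∀ i, Adapted (ds i)) (h : D → ℕ → ℝ)
    {s t : ℕ} (hst : s < t) (ht : t ≤ K + 1) :
    ∑ o : Obs K L A, p o * (DstM p y ds h s o * DstM p y ds h t o) = 0 := by
  simp_rw [DstM_eq_sum_Dst p y ds h t, Finset.mul_sum]
  rw [Finset.sum_comm]
  refine Finset.sum_eq_zero fun i _ => ?_
  calc _ = h i t * ∑ o : Obs K L A, p o * (DstM p y ds h s o * Dst p y (ds i) t o) := by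
        rw [Finset.mul_sum]
        exact Finset.sum_congr rfl fun o _ => by ring
    _ = 0 := by
        rw [sum_mul_Dst_eq_zero hp y (hds i) ⟨t, Nat.lt_succ_of_le ht⟩
          (DstM_dependsOnHistory p y hds h hst), mul_zero]

end Marginals

/-- orthogonality of the components of the working-MSM efficient influence
function, and the decomposition `E_p[(Σ_t D*_t)²] = Σ_t E_p[(D*_t)²] = Σ_t σ²_t`. -/
theorem msm_components_orthogonal [∀ t, Nonempty (L t)] [∀ t, Nonempty (A t)]
    {D : Type} [Fintype D] [Nonempty D]
    (p : Obs K L A → ℝ) (hp : ∀ o, 0 < p o) (hp1 : ∑ o : Obs K L A, p o = 1)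
    (y : L (Fin.last (K + 1)) → ℝ)
    (ds : D → ∀ t : Fin (K + 1), Traj K L → A t) (hds : ∀ i, Adapted (ds i))
    (h : D → ℕ → ℝ) :
    (∀ s t : ℕ, s ≤ K + 1 → t ≤ K + 1 → s ≠ t →
      ∑ o : Obs K L A, p o * (DstM p y ds h s o * DstM p y ds h t o) = 0) ∧
    ∑ o : Obs K L A, p o * (∑ t ∈ Finset.range (K + 2), DstM p y ds h t o) ^ 2
      = ∑ t ∈ Finset.range (K + 2), ∑ o : Obs K L A, p o * DstM p y ds h t o ^ 2 := by
  have orth : ∀ s t : ℕ, s ≤ K + 1 → t ≤ K + 1 → s ≠ t →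
      ∑ o : Obs K L A, p o * (DstM p y ds h s o * DstM p y ds h t o) = 0 := by
    intro s t hs ht hst
    rcases hst.lt_or_gt with hlt | hgt
    · exact sum_mul_DstM_mul_DstM_of_lt hp y hds h hlt ht
    · simp_rw [mul_comm (DstM p y ds h s _)]
      exact sum_mul_DstM_mul_DstM_of_lt hp y hds h hgt hs
  refine ⟨orth, ?_⟩
  simp_rw [sq, Finset.sum_mul_sum, Finset.mul_sum]
  rw [Finset.sum_comm]
  refine Finset.sum_congr rfl fun s hs => ?_
  rw [Finset.sum_comm]
  refine Finset.sum_eq_single_of_mem s hs fun t ht hts => ?_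
  exact orth s t (Nat.lt_succ_iff.1 (Finset.mem_range.1 hs))
    (Nat.lt_succ_iff.1 (Finset.mem_range.1 ht)) hts.symm

end
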